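/- Let μ and ν be radial Borel probability measures on ℝ³ supported in the closed unit ball with μ({0}) = 0, and define g(a) := max_{0≤b≤a} { Ψ_{μν}(a,b) − Ψ_{μν}(b,b)₊/2 } for a ≥ 0. Then g ∈ 𝓕_{μν} and there is a constant c > 0 (depending only on μ and ν) such that c·min(a³,a⁶) ≤ g(a) ≤ 2a⁶·(𝟙(a ≤ 2) + 𝟙(a > 2)/(a−1)³) ≤ min(2a⁶, 16a³) for all a ≥ 0. Moreover g(a)/a³ → max_{0≤b≤1} b³(1 − b V_μ(b e₁)) as a → ∞, where V_μ = μ ∗ |·|^{−1}. -/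

import Mathlib

open MeasureTheory ENNReal Set Metric Filter Real Topology
open scoped RealInnerProductSpace

noncomputable section

/-- Three-dimensional Euclidean space. -/
abbrev E3 := EuclideanSpace ℝ (Fin 3)

/-- The Coulomb kernel `|x-y|⁻¹`, valued in `ℝ≥0∞` (equal to `∞` on the diagonal). -/
def coul (x y : E3) : ℝ≥0∞ := (ENNReal.ofReal ‖x - y‖)⁻¹

/-- The Coulomb energy `D(ν₁,ν₂) = (1/2)∬ |x-y|⁻¹ dν₁ dν₂`, valued in `ℝ≥0∞`. -/
def DD (ν₁ ν₂ : Measure E3) : ℝ≥0∞ := 2⁻¹ * ∫⁻ x, ∫⁻ y, coul x y ∂ν₂ ∂ν₁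

/-- The real-valued Coulomb energy `D(ν₁,ν₂)`. -/
def Dr (ν₁ ν₂ : Measure E3) : ℝ := (DD ν₁ ν₂).toReal

/-- A measure on `ℝ³` is radial if it is invariant under all linear isometries
(rotations about the origin). -/
def IsRadial (μ : Measure E3) : Prop := ∀ e : E3 ≃ₗᵢ[ℝ] E3, Measure.map e μ = μ

/-- `μ_{v,a}` : the measure `μ` dilated by `1/a` and recentered at `v`, i.e. the pushforward
of `μ` under `u ↦ v + u/a`. -/
def dilate (μ : Measure E3) (v : E3) (a : ℝ) : Measure E3 :=
  Measure.map (fun u => v + a⁻¹ • u) μ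

/-- The first basis vector `e₁ = (1,0,0)`. -/
def e1 : E3 := EuclideanSpace.single (0 : Fin 3) (1 : ℝ)

/-- `Φ_{μν}(a,b) = a³b³(1 - 2D(μ_{0,a}, ν_{e₁,b}))`, extended by `0` when `a = 0` or `b = 0`. -/
def Phi (μ ν : Measure E3) (a b : ℝ) : ℝ :=
  if 0 < a ∧ 0 < b then a ^ 3 * b ^ 3 * (1 - 2 * Dr (dilate μ 0 a) (dilate ν e1 b)) else 0

/-- `Ψ_{μν} = Φ_{μν} + Φ_{νμ} - Φ_{νν}`. -/
def Psi (μ ν : Measure E3) (a b : ℝ) : ℝ := Phi μ ν a b + Phi ν μ a b - Phi ν ν a b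

/-- The class `𝓕_{μν}` of continuous nonnegative functions on `[0,∞)` such that
`Ψ_{μν}(a,b) ≤ f(a)+f(b)` for all `a,b ≥ 0`. -/
def FF (μ ν : Measure E3) : Set (ℝ → ℝ) :=
  {f | ContinuousOn f (Ici 0) ∧ (∀ a, 0 ≤ a → 0 ≤ f a) ∧
    ∀ a b, 0 ≤ a → 0 ≤ b → Psi μ ν a b ≤ f a + f b}

/-- `I(μ,ν) = inf_{f ∈ 𝓕_{μν}} ∫ |z|⁻⁷ f(|z|) dz`. -/
def II (μ ν : Measure E3) : ℝ≥0∞ :=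
  ⨅ f ∈ FF μ ν, ∫⁻ z : E3, ENNReal.ofReal (‖z‖ ^ (-7 : ℝ) * f ‖z‖)

/-- The Coulomb potential `V_μ = μ ∗ |·|⁻¹` generated by `μ`. -/
def Vpot (μ : Measure E3) (x : E3) : ℝ := (∫⁻ y, coul x y ∂μ).toReal

/-- `g(a) = max_{0 ≤ b ≤ a} { Ψ_{μν}(a,b) - Ψ_{μν}(b,b)₊/2 }`. -/
def gPsi (μ ν : Measure E3) (a : ℝ) : ℝ :=
  sSup ((fun b => Psi μ ν a b - max (Psi μ ν b b) 0 / 2) '' Icc 0 a)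


lemma e3_to_prod (f : ℝ → ℝ → ℝ → ℝ≥0∞)
    (hf : Measurable (fun p : ℝ × ℝ × ℝ => f p.1 p.2.1 p.2.2)) :
    ∫⁻ u : E3, f (u 0) (u 1) (u 2) = ∫⁻ z : ℝ, ∫⁻ q : ℝ × ℝ, f z q.1 q.2 := by
  have h1 := (EuclideanSpace.volume_preserving_symm_measurableEquiv_toLp (Fin 3)).lintegral_comp_emb
    (MeasurableEquiv.measurableEmbedding _) (fun v : Fin 3 → ℝ => f (v 0) (v 1) (v 2))
  have h2 := (volume_preserving_piFinSuccAbove (fun _ : Fin 3 => ℝ) 0).lintegral_comp_emb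
    (MeasurableEquiv.measurableEmbedding _) (fun v : ℝ × (Fin 2 → ℝ) => f v.1 (v.2 0) (v.2 1))
  have hm : Measurable (fun v : ℝ × (Fin 2 → ℝ) => f v.1 (v.2 0) (v.2 1)) := by
    exact hf.comp (f := fun v : ℝ × (Fin 2 → ℝ) => (v.1, v.2 0, v.2 1)) (by fun_prop)
  have h3 : ∀ z, ∫⁻ q : ℝ × ℝ, f z q.1 q.2 = ∫⁻ v : Fin 2 → ℝ, f z (v 0) (v 1) := by
    intro z
    exact ((volume_preserving_finTwoArrow ℝ).lintegral_comp_emb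
      (MeasurableEquiv.measurableEmbedding _) (fun q : ℝ × ℝ => f z q.1 q.2)).symm
  simp_rw [h3]
  rw [Measure.volume_eq_prod, lintegral_prod _ hm.aemeasurable] at h2
  rw [← h2]
  exact h1

lemma polar_radial (k : ℝ → ℝ≥0∞) (hk : Measurable k) :
    ∫⁻ q : ℝ × ℝ, k (q.1 ^ 2 + q.2 ^ 2) =
      ENNReal.ofReal (2 * π) * ∫⁻ r in Ioi (0:ℝ), ENNReal.ofReal r * k (r ^ 2) := by
  rw [← lintegral_comp_polarCoord_symm]
  have : ∀ p : ℝ × ℝ, ENNReal.ofReal p.1 • k ((polarCoord.symm p).1 ^ 2 + (polarCoord.symm p).2 ^ 2)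
      = ENNReal.ofReal p.1 * k (p.1 ^ 2) := by
    intro p
    simp only [polarCoord_symm_apply, smul_eq_mul]
    congr 2
    nlinarith [Real.sin_sq_add_cos_sq p.2]
  simp_rw [this]
  rw [polarCoord_target, Measure.volume_eq_prod, setLIntegral_prod]
  · simp only [lintegral_const, MeasurableSet.univ, Measure.restrict_apply, univ_inter, Real.volume_Ioo]
    rw [lintegral_mul_const _ (by fun_prop), mul_comm]
    congr 2; ring
  · fun_prop

lemma arch0 (h : ℝ → ℝ → ℝ≥0∞) (hh : Measurable (fun p : ℝ × ℝ => h p.1 p.2)) :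
    ∫⁻ u : E3, h (u 0) ‖u‖ = ENNReal.ofReal (2 * π) *
      ∫⁻ s in Ioi (0:ℝ), ∫⁻ θ in Ioo (-π) π,
        ENNReal.ofReal s * (ENNReal.ofReal (s * sin θ) * h (s * cos θ) s) := by
  have e1 : ∀ u : E3, h (u 0) ‖u‖ = h (u 0) (√((u 0)^2 + ((u 1)^2 + (u 2)^2))) := by
    intro u
    rw [EuclideanSpace.norm_eq, Fin.sum_univ_three]
    simp [add_assoc]
  simp_rw [e1]
  have hm2 : Measurable (fun p : ℝ × ℝ => h p.1 (√(p.1 ^ 2 + p.2))) :=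
    hh.comp (f := fun p : ℝ × ℝ => (p.1, √(p.1 ^ 2 + p.2))) (by fun_prop)
  rw [e3_to_prod (fun x y z => h x (√(x^2 + (y^2 + z^2))))
    (hh.comp (f := fun p : ℝ × ℝ × ℝ => (p.1, √(p.1 ^ 2 + (p.2.1^2 + p.2.2^2)))) (by fun_prop))]
  have e2 : ∀ z : ℝ, ∫⁻ q : ℝ × ℝ, h z (√(z ^ 2 + (q.1 ^ 2 + q.2 ^ 2))) =
      ENNReal.ofReal (2 * π) * ∫⁻ r, ENNReal.ofReal r * h z (√(z ^ 2 + r ^ 2)) := by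
    intro z
    rw [polar_radial (fun w => h z (√(z^2 + w)))
      (hm2.comp (f := fun w => (z, w)) (by fun_prop))]
    congr 1
    rw [← lintegral_indicator measurableSet_Ioi]
    congr 1
    ext r
    by_cases hr : 0 < r
    · simp [indicator, hr]
    · simp [indicator, hr, ENNReal.ofReal_of_nonpos (not_lt.1 hr)]
  simp_rw [e2]
  have hm3 : Measurable (fun p : ℝ × ℝ => ENNReal.ofReal p.2 * h p.1 (√(p.1 ^ 2 + p.2 ^ 2))) := by
    refine Measurable.mul (by fun_prop) ?_
    exact hh.comp (f := fun p : ℝ × ℝ => (p.1, √(p.1 ^ 2 + p.2^2))) (by fun_prop)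
  rw [lintegral_const_mul _ (by exact hm3.lintegral_prod_right')]
  congr 1
  rw [← lintegral_prod _ hm3.aemeasurable, ← Measure.volume_eq_prod, ← lintegral_comp_polarCoord_symm,
    polarCoord_target, Measure.volume_eq_prod, setLIntegral_prod]
  · refine setLIntegral_congr_fun measurableSet_Ioi ?_
    intro s hs
    simp only [polarCoord_symm_apply, smul_eq_mul]
    have : ∀ θ, √((s * cos θ) ^ 2 + (s * sin θ) ^ 2) = s := by
      intro θ
      rw [show (s * cos θ) ^ 2 + (s * sin θ) ^ 2 = s ^ 2 by nlinarith [Real.sin_sq_add_cos_sq θ]]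
      exact Real.sqrt_sq (le_of_lt hs)
    simp_rw [this]
  · apply Measurable.aemeasurable
    simp only [smul_eq_mul]
    refine Measurable.mul (by fun_prop) ?_
    refine hm3.comp ?_
    exact (continuous_polarCoord_symm).measurable

lemma cos_subst (f : ℝ → ℝ≥0∞) :
    ∫⁻ t in Ioo (-1:ℝ) 1, f t = ∫⁻ θ in Ioo (0:ℝ) π, ENNReal.ofReal (sin θ) * f (cos θ) := by
  have himg : cos '' Ioo 0 π = Ioo (-1) 1 := by
    ext t
    constructor
    · rintro ⟨θ, hθ, rfl⟩
      constructor
      · have := Real.strictAntiOn_cos (a := θ) (b := π) ⟨hθ.1.le, hθ.2.le⟩ ⟨pi_pos.le, le_rfl⟩ hθ.2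
        simpa using this
      · have := Real.strictAntiOn_cos (a := 0) (b := θ) ⟨le_rfl, pi_pos.le⟩ ⟨hθ.1.le, hθ.2.le⟩ hθ.1
        simpa using this
    · intro ht
      refine ⟨arccos t, ⟨Real.arccos_pos.2 ht.2, ?_⟩, Real.cos_arccos ht.1.le ht.2.le⟩
      rw [Real.arccos_lt_pi]; exact ht.1
  rw [← himg, lintegral_image_eq_lintegral_abs_deriv_mul measurableSet_Ioo
    (fun x _ => (Real.hasDerivAt_cos x).hasDerivWithinAt)
    (Real.injOn_cos.mono Ioo_subset_Icc_self)]
  refine setLIntegral_congr_fun measurableSet_Ioo ?_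
  intro θ hθ
  simp only [abs_neg]
  rw [abs_of_pos (Real.sin_pos_of_pos_of_lt_pi hθ.1 hθ.2)]

/-- On the unit ball, `u₀/‖u‖` is uniformly distributed. -/
lemma arch1 : ∃ C : ℝ≥0∞, ∀ f : ℝ → ℝ≥0∞, Measurable f →
    ∫⁻ u in ball (0:E3) 1, f (u 0 / ‖u‖) = C * ∫⁻ t in Ioo (-1:ℝ) 1, f t := by
  refine ⟨ENNReal.ofReal (2 * π) * ∫⁻ s in Ioi (0:ℝ), ENNReal.ofReal s * (ENNReal.ofReal s *
    (Iio (1:ℝ)).indicator 1 s), fun f hf => ?_⟩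
  have h0 := arch0 (fun z p => (Iio (1:ℝ)).indicator 1 p * f (z / p)) (by
    refine Measurable.mul ?_ (by fun_prop)
    exact (measurable_one.indicator measurableSet_Iio).comp measurable_snd)
  have h1 : ∫⁻ u in ball (0:E3) 1, f (u 0 / ‖u‖) =
      ∫⁻ u : E3, (Iio (1:ℝ)).indicator 1 ‖u‖ * f (u 0 / ‖u‖) := by
    rw [← lintegral_indicator measurableSet_ball]
    congr 1
    ext u
    by_cases hu : ‖u‖ < 1 <;> simp [indicator, hu]
  rw [h1, h0, mul_assoc]
  congr 1
  rw [cos_subst, ← lintegral_mul_const]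
  · refine setLIntegral_congr_fun measurableSet_Ioi ?_
    intro s hs
    have hs' : 0 < s := hs
    simp only
    have : ∀ θ, ENNReal.ofReal s * (ENNReal.ofReal (s * sin θ) * ((Iio (1:ℝ)).indicator 1 s * f (s * cos θ / s)))
        = (ENNReal.ofReal s * (ENNReal.ofReal s * (Iio (1:ℝ)).indicator 1 s)) *
          (ENNReal.ofReal (sin θ) * f (cos θ)) := by
      intro θ
      rw [ENNReal.ofReal_mul hs'.le, mul_div_cancel_left₀ _ hs'.ne']
      ring
    simp_rw [this]
    rw [lintegral_const_mul _ (by fun_prop)]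
    congr 1
    rw [← lintegral_indicator measurableSet_Ioo, ← lintegral_indicator measurableSet_Ioo]
    congr 1
    ext θ
    by_cases h1 : θ ∈ Ioo 0 π
    · have : θ ∈ Ioo (-π) π := ⟨by linarith [h1.1, pi_pos], h1.2⟩
      simp only [indicator, h1, this, if_true]
    · by_cases h2 : θ ∈ Ioo (-π) π
      · have h3 : θ ≤ 0 := by
          by_contra h; exact h1 ⟨not_le.1 h, h2.2⟩
        have : sin θ ≤ 0 := Real.sin_nonpos_of_nonpos_of_neg_pi_le h3 h2.1.le
        simp [indicator, h1, h2, ENNReal.ofReal_of_nonpos this]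
      · simp only [indicator, h1, h2, if_false]
  · have : Measurable ((Iio (1:ℝ)).indicator (1 : ℝ → ℝ≥0∞)) := measurable_one.indicator measurableSet_Iio
    fun_prop

lemma norm_e1 : ‖e1‖ = 1 := by simp [e1]

lemma inner_e1 (y : E3) : inner ℝ y e1 = y 0 := by
  simp [e1, EuclideanSpace.inner_single_right]

/-- rotate a vector to a multiple of `e1`. -/
lemma exists_rot (z : E3) : ∃ e : E3 ≃ₗᵢ[ℝ] E3, e z = ‖z‖ • e1 := by
  refine ⟨(ℝ ∙ (z - ‖z‖ • e1))ᗮ.reflection, Submodule.reflection_sub ?_⟩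
  simp [norm_smul, norm_e1]

lemma radial_lintegral {ν : Measure E3} (hν : IsRadial ν) (e : E3 ≃ₗᵢ[ℝ] E3) (f : E3 → ℝ≥0∞) :
    ∫⁻ y, f (e y) ∂ν = ∫⁻ y, f y ∂ν := by
  conv_rhs => rw [← hν e]
  exact (e.toHomeomorph.measurableEmbedding.lintegral_map f (μ := ν)).symm

lemma radial_inner {ν : Measure E3} (hν : IsRadial ν) (F : ℝ → ℝ → ℝ≥0∞) (z : E3) :
    ∫⁻ y, F (inner ℝ y z) ‖y‖ ∂ν = ∫⁻ y, F (‖z‖ * y 0) ‖y‖ ∂ν := by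
  obtain ⟨e, he⟩ := exists_rot z
  rw [← radial_lintegral hν e (fun y => F (‖z‖ * y 0) ‖y‖)]
  congr 1
  ext y
  rw [← inner_e1 (e y), ← real_inner_smul_right, ← he, e.inner_map_map, e.norm_map]

lemma ball_radial : IsRadial ((volume : Measure E3).restrict (ball (0:E3) 1)) := by
  intro e
  have := e.measurePreserving
  have h2 := this.restrict_preimage (s := ball (0:E3) 1) measurableSet_ball
  have h3 : e ⁻¹' ball (0:E3) 1 = ball 0 1 := by
    ext x; simp
  rw [h3] at h2
  exact h2.map_eq

/-- Archimedes for radial measures. -/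
lemma radial_arch {ν : Measure E3} [IsProbabilityMeasure ν] (hν : IsRadial ν) (F : ℝ → ℝ → ℝ≥0∞)
    (hF : Measurable (fun p : ℝ × ℝ => F p.1 p.2)) :
    ∫⁻ y, F (y 0) ‖y‖ ∂ν = ∫⁻ y, (2⁻¹ * ∫⁻ t in Ioo (-1:ℝ) 1, F (‖y‖ * t) ‖y‖) ∂ν := by
  obtain ⟨C, hC⟩ := arch1
  set γ := (volume : Measure E3).restrict (ball (0:E3) 1) with hγ
  have hm : γ univ = C * 2 := by
    have := hC (fun _ => 1) measurable_const
    simp only [lintegral_const, one_mul, Measure.restrict_apply MeasurableSet.univ, univ_inter, Real.volume_Ioo] at this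
    rw [this]
    norm_num
  have hγ0 : γ univ ≠ 0 := by
    rw [hγ, Measure.restrict_apply MeasurableSet.univ, univ_inter]
    exact (measure_ball_pos _ _ one_pos).ne'
  have hγt : γ univ ≠ ∞ := by
    rw [hγ, Measure.restrict_apply MeasurableSet.univ, univ_inter]
    exact measure_ball_lt_top.ne
  have : IsFiniteMeasure γ := ⟨hγt.lt_top⟩
  have hmeas : Measurable (fun p : E3 × E3 => F (inner ℝ p.2 p.1 / ‖p.1‖) ‖p.2‖) :=
    hF.comp (f := fun p : E3 × E3 => ((inner ℝ p.2 p.1 / ‖p.1‖ : ℝ), ‖p.2‖)) (by fun_prop)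
  have hsw := lintegral_lintegral_swap (μ := γ) (ν := ν)
    (f := fun u y => F (inner ℝ y u / ‖u‖) ‖y‖) hmeas.aemeasurable
  have hL : ∫⁻ u, ∫⁻ y, F (inner ℝ y u / ‖u‖) ‖y‖ ∂ν ∂γ = (C * 2) * ∫⁻ y, F (y 0) ‖y‖ ∂ν := by
    rw [← hm, mul_comm, ← lintegral_const]
    have hne : ∀ᵐ u ∂γ, u ≠ (0:E3) := by
      have : γ {0} = 0 := by
        refine le_antisymm ((Measure.restrict_apply_le _ _).trans ?_) zero_le
        simp
      exact measure_eq_zero_iff_ae_notMem.1 this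
    refine lintegral_congr_ae ?_
    filter_upwards [hne] with u hu
    rw [radial_inner hν (fun s p => F (s / ‖u‖) p) u]
    have : ‖u‖ ≠ 0 := by simpa using hu
    simp_rw [mul_div_cancel_left₀ _ this]
  have hR : ∀ y, ∫⁻ u, F (inner ℝ y u / ‖u‖) ‖y‖ ∂γ = C * ∫⁻ t in Ioo (-1:ℝ) 1, F (‖y‖ * t) ‖y‖ := by
    intro y
    have hc : ∀ u : E3, (inner ℝ y u : ℝ) = inner ℝ u y := fun u => real_inner_comm _ _
    simp_rw [hc]
    rw [radial_inner ball_radial (fun s p => F (s / p) ‖y‖) y]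
    rw [← hC (fun t => F (‖y‖ * t) ‖y‖)
      (hF.comp (f := fun t : ℝ => (‖y‖ * t, ‖y‖)) (by fun_prop))]
    simp_rw [mul_div_assoc]
    rfl
  simp_rw [hR] at hsw
  rw [hL] at hsw
  have hC0 : C ≠ 0 := by rintro rfl; simp [hm] at hγ0
  have hCt : C ≠ ∞ := by rintro rfl; apply hγt; rw [hm]; simp
  have hmm : Measurable (fun y : E3 => ∫⁻ t in Ioo (-1:ℝ) 1, F (‖y‖ * t) ‖y‖) := by
    refine Measurable.lintegral_prod_right' (f := fun p : E3 × ℝ => F (‖p.1‖ * p.2) ‖p.1‖) ?_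
    exact hF.comp (f := fun p : E3 × ℝ => (‖p.1‖ * p.2, ‖p.1‖)) (by fun_prop)
  rw [lintegral_const_mul _ hmm] at hsw ⊢
  rw [mul_assoc] at hsw
  have := (ENNReal.mul_right_inj hC0 hCt).1 hsw
  rw [← this, ← mul_assoc, ENNReal.inv_mul_cancel (by norm_num) (by norm_num), one_mul]

/-- Antiderivative of `p ↦ p / max ρ p`. -/
def Hf (ρ p : ℝ) : ℝ := p + (max (ρ - p) 0) ^ 2 / (2 * ρ)

/-- The mean of `1 / max ρ |z|` over the sphere of radius `σ` centred at `e1`. -/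
def wk (ρ σ : ℝ) : ℝ :=
  if σ = 0 then (max 1 ρ)⁻¹ else (Hf ρ (1 + σ) - Hf ρ |1 - σ|) / (2 * σ)

lemma hasDerivAt_posSq (x : ℝ) : HasDerivAt (fun x : ℝ => (max x 0) ^ 2) (2 * max x 0) x := by
  rcases lt_trichotomy x 0 with h | h | h
  · rw [max_eq_right h.le, mul_zero]
    refine (hasDerivAt_const x (0:ℝ)).congr_of_eventuallyEq ?_
    filter_upwards [Iio_mem_nhds h] with y hy
    rw [max_eq_right (le_of_lt hy)]; norm_num
  · subst h
    simp only [max_self, mul_zero]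
    rw [hasDerivAt_iff_isLittleO]
    simp only [sub_zero, max_self, smul_zero, ne_eq, OfNat.ofNat_ne_zero, not_false_eq_true, zero_pow]
    refine Asymptotics.IsBigO.trans_isLittleO (g := fun x : ℝ => x ^ 2) ?_ ?_
    · refine Asymptotics.IsBigO.of_bound 1 (Eventually.of_forall fun y => ?_)
      simp only [norm_pow, Real.norm_eq_abs, one_mul]
      refine pow_le_pow_left₀ (abs_nonneg _) ?_ 2
      rcases le_total y 0 with h | h
      · rw [max_eq_right h]; simp
      · rw [max_eq_left h]
    · simpa using (Asymptotics.isLittleO_pow_id (𝕜 := ℝ) (n := 2) (by norm_num))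
  · rw [max_eq_left h.le]
    have := (hasDerivAt_pow 2 x)
    simp only [Nat.cast_ofNat, Nat.add_one_sub_one, pow_one] at this
    refine this.congr_of_eventuallyEq ?_
    filter_upwards [Ioi_mem_nhds h] with y hy
    rw [max_eq_left (le_of_lt hy)]

lemma hasDerivAt_Hf {ρ p : ℝ} (hp : 0 < p) :
    HasDerivAt (Hf ρ) (p * (max ρ p)⁻¹) p := by
  have h1 : HasDerivAt (fun q : ℝ => (max (ρ - q) 0) ^ 2) (2 * max (ρ - p) 0 * (-1)) p :=
    (hasDerivAt_posSq (ρ - p)).comp p ((hasDerivAt_id p).const_sub ρ)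
  have h2 := (hasDerivAt_id p).add (h1.div_const (2 * ρ))
  refine h2.congr_deriv ?_
  rcases le_total ρ p with h | h
  · rw [max_eq_right h, max_eq_right (by linarith)]
    field_simp
    simp
  · have : 0 < ρ := by linarith
    rw [max_eq_left h, max_eq_left (by linarith)]
    field_simp
    ring

lemma continuous_Hf (ρ : ℝ) : Continuous (Hf ρ) := by
  unfold Hf; fun_prop

lemma calc_kernel {ρ d σ : ℝ} (hρ : 0 ≤ ρ) (hd : 0 < d) (hσ : 0 < σ) :
    ∫⁻ t in Ioo (-1:ℝ) 1, (ENNReal.ofReal (max ρ √(d ^ 2 + σ ^ 2 + 2 * (d * σ) * t)))⁻¹ =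
      ENNReal.ofReal ((Hf ρ (d + σ) - Hf ρ |d - σ|) / (d * σ)) ∧
    0 ≤ (Hf ρ (d + σ) - Hf ρ |d - σ|) / (d * σ) := by
  have hds : 0 < d * σ := mul_pos hd hσ
  set G : ℝ → ℝ := fun t => Hf ρ (√(d ^ 2 + σ ^ 2 + 2 * (d * σ) * t)) / (d * σ) with hG
  set G' : ℝ → ℝ := fun t => (max ρ √(d ^ 2 + σ ^ 2 + 2 * (d * σ) * t))⁻¹ with hG'
  have hpos : ∀ t ∈ Ioo (-1:ℝ) 1, 0 < d ^ 2 + σ ^ 2 + 2 * (d * σ) * t := by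
    intro t ht
    nlinarith [sq_nonneg (d - σ), mul_pos hds (by linarith [ht.1] : 0 < 1 + t)]
  have hcont : ContinuousOn G (Icc (-1) 1) := by
    refine Continuous.continuousOn ?_
    have := continuous_Hf ρ
    fun_prop
  have hder : ∀ t ∈ Ioo (-1:ℝ) 1, HasDerivAt G (G' t) t := by
    intro t ht
    have hp := hpos t ht
    have hq := Real.sqrt_pos.2 hp
    have h1 : HasDerivAt (fun t : ℝ => d ^ 2 + σ ^ 2 + 2 * (d * σ) * t) (2 * (d * σ)) t := by
      simpa using ((hasDerivAt_id t).const_mul (2 * (d * σ))).const_add (d ^ 2 + σ ^ 2)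
    have h2 := h1.sqrt hp.ne'
    have h3 := ((hasDerivAt_Hf (ρ := ρ) hq).comp t h2).div_const (d * σ)
    refine h3.congr_deriv ?_
    have hmx : 0 < max ρ √(d ^ 2 + σ ^ 2 + 2 * (d * σ) * t) := lt_max_of_lt_right hq
    simp only [hG']
    generalize √(d ^ 2 + σ ^ 2 + 2 * (d * σ) * t) = q at hq hmx
    field_simp
  have hnn : ∀ t ∈ Ioo (-1:ℝ) 1, 0 ≤ G' t := by
    intro t ht
    simp only [hG']
    positivity
  have hIn1 := intervalIntegral.integrableOn_deriv_of_nonneg hcont hder hnn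
  have hii : IntervalIntegrable G' volume (-1) 1 :=
    (intervalIntegrable_iff_integrableOn_Ioc_of_le (by norm_num)).2 hIn1
  have hval := intervalIntegral.integral_eq_sub_of_hasDerivAt_of_le (by norm_num) hcont hder hii
  have hG1 : G 1 - G (-1) = (Hf ρ (d + σ) - Hf ρ |d - σ|) / (d * σ) := by
    simp only [hG]
    rw [show d ^ 2 + σ ^ 2 + 2 * (d * σ) * 1 = (d + σ) ^ 2 by ring,
      show d ^ 2 + σ ^ 2 + 2 * (d * σ) * (-1) = (d - σ) ^ 2 by ring,
      Real.sqrt_sq (by positivity), Real.sqrt_sq_eq_abs]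
    ring
  rw [hG1, intervalIntegral.integral_of_le (by norm_num), integral_Ioc_eq_integral_Ioo] at hval
  have hIn2 : Integrable G' (volume.restrict (Ioo (-1) 1)) := hIn1.mono_set Ioo_subset_Ioc_self
  have hae : 0 ≤ᵐ[volume.restrict (Ioo (-1:ℝ) 1)] G' := by
    filter_upwards [ae_restrict_mem measurableSet_Ioo] with t ht using hnn t ht
  constructor
  · rw [← hval, ofReal_integral_eq_lintegral_ofReal hIn2 hae]
    refine setLIntegral_congr_fun measurableSet_Ioo ?_
    intro t ht
    simp only [hG']
    rw [ENNReal.ofReal_inv_of_pos (lt_max_of_lt_right (Real.sqrt_pos.2 (hpos t ht)))]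
  · rw [← hval]
    exact integral_nonneg_of_ae hae

lemma wk_nonneg {ρ σ : ℝ} (hρ : 0 ≤ ρ) (hσ : 0 ≤ σ) : 0 ≤ wk ρ σ := by
  unfold wk
  split_ifs with h
  · positivity
  · have hs : 0 < σ := lt_of_le_of_ne hσ (Ne.symm h)
    have := (calc_kernel hρ one_pos hs).2
    rw [one_mul] at this
    have h2 : (Hf ρ (1 + σ) - Hf ρ |1 - σ|) / (2 * σ) =
      2⁻¹ * ((Hf ρ (1 + σ) - Hf ρ |1 - σ|) / σ) := by field_simp
    rw [h2]; positivity

lemma half_ofReal (x : ℝ) : (2:ℝ≥0∞)⁻¹ * ENNReal.ofReal x = ENNReal.ofReal (2⁻¹ * x) := by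
  rw [ENNReal.ofReal_mul (by norm_num), ENNReal.ofReal_inv_of_pos (by norm_num)]
  norm_num

lemma half_const (c : ℝ≥0∞) : (2:ℝ≥0∞)⁻¹ * ∫⁻ _ in Ioo (-1:ℝ) 1, c = c := by
  simp only [lintegral_const, Measure.restrict_apply MeasurableSet.univ, univ_inter, Real.volume_Ioo]
  rw [show (1 - (-1) : ℝ) = 2 by norm_num, mul_comm c, ← mul_assoc]
  rw [show ENNReal.ofReal 2 = 2 by norm_num, ENNReal.inv_mul_cancel (by norm_num) (by norm_num), one_mul]

lemma calc_wk {ρ σ : ℝ} (hρ : 0 ≤ ρ) (hσ : 0 ≤ σ) :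
    2⁻¹ * ∫⁻ t in Ioo (-1:ℝ) 1, (ENNReal.ofReal (max ρ √(1 ^ 2 + σ ^ 2 + 2 * (1 * σ) * t)))⁻¹ =
      ENNReal.ofReal (wk ρ σ) := by
  unfold wk
  split_ifs with h
  · subst h
    simp only [mul_zero, zero_mul, add_zero]
    rw [half_const, ENNReal.ofReal_inv_of_pos (by positivity), max_comm]
    norm_num
  · have hs : 0 < σ := lt_of_le_of_ne hσ (Ne.symm h)
    rw [(calc_kernel hρ one_pos hs).1, half_ofReal]
    congr 1
    field_simp

lemma calc_newton {d σ : ℝ} (hd : 0 < d) (hσ : 0 ≤ σ) :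
    2⁻¹ * ∫⁻ t in Ioo (-1:ℝ) 1, (ENNReal.ofReal √(d ^ 2 + σ ^ 2 + 2 * (d * σ) * t))⁻¹ =
      (ENNReal.ofReal (max σ d))⁻¹ := by
  rcases hσ.eq_or_lt with h | h
  · subst h
    simp only [mul_zero, zero_mul, add_zero]
    rw [half_const, max_eq_right hd.le]
    norm_num [Real.sqrt_sq hd.le]
  · have := (calc_kernel (le_refl 0) hd h).1
    simp only [max_eq_right (Real.sqrt_nonneg _)] at this
    rw [this, half_ofReal, ← ENNReal.ofReal_inv_of_pos (lt_max_of_lt_right hd)]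
    congr 1
    simp only [Hf, mul_zero]
    rcases le_total σ d with h' | h'
    · rw [max_eq_right h', abs_of_nonneg (by linarith)]
      field_simp; ring
    · rw [max_eq_left h', abs_of_nonpos (by linarith)]
      field_simp; ring

/-- Newton's theorem. -/
lemma newton {μ : Measure E3} [IsProbabilityMeasure μ] (hμ : IsRadial μ) {a : ℝ} (ha : 0 < a) (z : E3) :
    ∫⁻ x, (ENNReal.ofReal ‖a⁻¹ • x - z‖)⁻¹ ∂μ =
      ∫⁻ x, (ENNReal.ofReal (max (‖x‖ / a) ‖z‖))⁻¹ ∂μ := by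
  rcases eq_or_ne z 0 with rfl | hz
  · congr 1
    ext x
    rw [sub_zero, norm_zero, max_eq_left (by positivity), norm_smul, norm_inv, Real.norm_of_nonneg ha.le]
    congr 2
    field_simp
  have hz' : 0 < ‖z‖ := norm_pos_iff.2 hz
  have h1 : ∀ x : E3, (ENNReal.ofReal ‖a⁻¹ • x - z‖)⁻¹ =
      (fun s p : ℝ => (ENNReal.ofReal √(‖z‖ ^ 2 + (p / a) ^ 2 + 2 * (s / a)))⁻¹) (inner ℝ x (-z)) ‖x‖ := by
    intro x
    simp only
    congr 2
    rw [← Real.sqrt_sq (norm_nonneg (a⁻¹ • x - z)), norm_sub_sq_real, norm_smul, real_inner_smul_left,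
      inner_neg_right, norm_inv, Real.norm_of_nonneg ha.le]
    congr 1
    ring
  simp_rw [h1]
  rw [radial_inner hμ (fun s p : ℝ => (ENNReal.ofReal √(‖z‖ ^ 2 + (p / a) ^ 2 + 2 * (s / a)))⁻¹), norm_neg, radial_arch hμ
    (fun s p : ℝ => (ENNReal.ofReal √(‖z‖ ^ 2 + (p / a) ^ 2 + 2 * (‖z‖ * s / a)))⁻¹) (by fun_prop)]
  congr 1
  ext x
  rw [← calc_newton hz' (by positivity : 0 ≤ ‖x‖ / a)]
  congr 1
  congr 1
  ext t
  congr 3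
  ring

lemma DD_eq {μ ν : Measure E3} [IsProbabilityMeasure μ] [IsProbabilityMeasure ν]
    (hμ : IsRadial μ) (hν : IsRadial ν) {a b : ℝ} (ha : 0 < a) (hb : 0 < b) :
    DD (dilate μ 0 a) (dilate ν e1 b) =
      2⁻¹ * ∫⁻ x, ∫⁻ y, ENNReal.ofReal (wk (‖x‖ / a) (‖y‖ / b)) ∂ν ∂μ := by
  unfold DD dilate
  congr 1
  have hcm : Measurable (fun p : E3 × E3 => coul p.1 p.2) := by
    unfold coul; fun_prop
  have : IsProbabilityMeasure (Measure.map (fun u : E3 => e1 + b⁻¹ • u) ν) :=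
    Measure.isProbabilityMeasure_map (by fun_prop)
  rw [lintegral_map (hcm.lintegral_prod_right') (by fun_prop)]
  have h1 : ∀ x : E3, ∫⁻ y, coul (0 + a⁻¹ • x) y ∂(Measure.map (fun u : E3 => e1 + b⁻¹ • u) ν) =
      ∫⁻ y, (ENNReal.ofReal ‖a⁻¹ • x - (e1 + b⁻¹ • y)‖)⁻¹ ∂ν := by
    intro x
    rw [lintegral_map (f := fun y => coul (0 + a⁻¹ • x) y) (by unfold coul; fun_prop) (by fun_prop)]
    simp [coul]
  simp_rw [h1]
  rw [lintegral_lintegral_swap (by fun_prop)]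
  simp_rw [newton hμ ha]
  rw [lintegral_lintegral_swap (by fun_prop)]
  congr 1
  ext x
  have h2 : ∀ y : E3, (ENNReal.ofReal (max (‖x‖ / a) ‖e1 + b⁻¹ • y‖))⁻¹ =
      (fun s p : ℝ => (ENNReal.ofReal (max (‖x‖ / a) √(1 ^ 2 + (p / b) ^ 2 + 2 * (s / b))))⁻¹) (y 0) ‖y‖ := by
    intro y
    simp only
    congr 3
    rw [← Real.sqrt_sq (norm_nonneg (e1 + b⁻¹ • y)), norm_add_sq_real, norm_smul, real_inner_smul_right,
      norm_inv, Real.norm_of_nonneg hb.le, norm_e1, real_inner_comm, inner_e1]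
    congr 1
    ring
  simp_rw [h2]
  rw [radial_arch hν (fun s p : ℝ => (ENNReal.ofReal (max (‖x‖ / a) √(1 ^ 2 + (p / b) ^ 2 + 2 * (s / b))))⁻¹)
    (by fun_prop)]
  congr 1
  ext y
  rw [← calc_wk (by positivity) (by positivity)]
  congr 1
  congr 1
  ext t
  congr 4
  ring

lemma wk_eq {ρ σ : ℝ} (hσ : 0 < σ) : wk ρ σ = (max 1 σ)⁻¹ -
    ((max (ρ - |1 - σ|) 0) ^ 2 - (max (ρ - (1 + σ)) 0) ^ 2) / (2 * ρ) / (2 * σ) := by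
  unfold wk Hf
  rw [if_neg hσ.ne']
  have : (max 1 σ)⁻¹ = (1 + σ - |1 - σ|) / (2 * σ) := by
    rcases le_total σ 1 with h | h
    · rw [max_eq_left h, abs_of_nonneg (by linarith)]; field_simp; ring
    · rw [max_eq_right h, abs_of_nonpos (by linarith)]; field_simp; ring
  rw [this]
  ring

lemma abs_one_sub_le {σ : ℝ} (hσ : 0 ≤ σ) : |1 - σ| ≤ 1 + σ := by
  rw [abs_le]; constructor <;> linarith

lemma wk_le {ρ σ : ℝ} (hρ : 0 ≤ ρ) (hσ : 0 ≤ σ) : wk ρ σ ≤ (max 1 σ)⁻¹ := by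
  rcases hσ.eq_or_lt with h | h
  · subst h
    simp only [wk, if_true]
    gcongr
  · rw [wk_eq h]
    have h1 : (max (ρ - (1 + σ)) 0) ^ 2 ≤ (max (ρ - |1 - σ|) 0) ^ 2 := by
      have := abs_one_sub_le hσ
      gcongr
    have : 0 ≤ ((max (ρ - |1 - σ|) 0) ^ 2 - (max (ρ - (1 + σ)) 0) ^ 2) / (2 * ρ) / (2 * σ) := by
      apply div_nonneg (div_nonneg _ _) <;> linarith
    linarith

lemma inv_max_le_one (σ : ℝ) : (max 1 σ)⁻¹ ≤ 1 := inv_le_one_of_one_le₀ (le_max_left _ _)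

lemma wk_le_one {ρ σ : ℝ} (hρ : 0 ≤ ρ) (hσ : 0 ≤ σ) : wk ρ σ ≤ 1 :=
  (wk_le hρ hσ).trans (inv_max_le_one _)

lemma wk_zero {σ : ℝ} (hσ : 0 ≤ σ) : wk 0 σ = (max 1 σ)⁻¹ := by
  rcases hσ.eq_or_lt with h | h
  · subst h; simp [wk]
  · rw [wk_eq h]; simp

lemma wk_close {ρ σ : ℝ} (hρ : 0 ≤ ρ) (hρ' : ρ ≤ 1 / 2) (hσ : 0 ≤ σ) :
    (max 1 σ)⁻¹ - ρ ≤ wk ρ σ := by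
  rcases hσ.eq_or_lt with h | h
  · subst h
    simp only [wk, if_true]
    rw [max_eq_left (by linarith : ρ ≤ 1)]; norm_num; exact hρ
  rcases hρ.eq_or_lt with h0 | h0
  · subst h0; rw [wk_zero hσ]; simp
  rw [wk_eq h]
  have h2 : max (ρ - (1 + σ)) 0 = 0 := max_eq_right (by linarith)
  rw [h2]
  have : ((max (ρ - |1 - σ|) 0) ^ 2 - 0 ^ 2) / (2 * ρ) / (2 * σ) ≤ ρ := by
    rcases le_total ρ |1 - σ| with h3 | h3
    · rw [max_eq_right (by linarith)]; simp [hρ]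
    · rw [max_eq_left (by linarith)]
      have h4 : 1 / 2 ≤ σ := by have := (abs_le.1 h3).2; linarith
      have h5 := abs_nonneg (1 - σ)
      rw [div_div, div_le_iff₀ (by positivity)]
      nlinarith [mul_pos h0 h0]
  linarith

lemma wk_one {ρ σ : ℝ} (hρ : 0 ≤ ρ) (hσ : 0 ≤ σ) (h : ρ + σ ≤ 1) : wk ρ σ = 1 := by
  rcases hσ.eq_or_lt with h' | h'
  · subst h'
    simp only [wk, if_true]
    rw [max_eq_left (by linarith : ρ ≤ 1)]; norm_num
  · rw [wk_eq h', abs_of_nonneg (by linarith), max_eq_left (by linarith : σ ≤ 1),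
      max_eq_right (by linarith : ρ - (1 - σ) ≤ 0), max_eq_right (by linarith : ρ - (1 + σ) ≤ 0)]
    simp

lemma wk_symm {ρ σ : ℝ} (hρ : 0 ≤ ρ) (hσ : 0 ≤ σ) : wk ρ σ = wk σ ρ := by
  rcases hσ.eq_or_lt with h | h
  · subst h; rw [wk_zero hρ]; simp [wk]
  rcases hρ.eq_or_lt with h0 | h0
  · subst h0; rw [wk_zero hσ]; simp [wk]
  unfold wk Hf
  rw [if_neg h.ne', if_neg h0.ne']
  have key : ∀ x y : ℝ, 0 < x → 0 < y → max (x - |1 - y|) 0 =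
      if y ≤ 1 then (if x + y ≤ 1 then 0 else x + y - 1) else (if y ≤ 1 + x then x + 1 - y else 0) := by
    intro x y hx hy
    split_ifs with c1 c2 c2
    · rw [abs_of_nonneg (by linarith), max_eq_right (by linarith)]
    · rw [abs_of_nonneg (by linarith), max_eq_left (by linarith)]; ring
    · rw [abs_of_nonpos (by linarith), max_eq_left (by linarith)]; ring
    · rw [abs_of_nonpos (by linarith), max_eq_right (by linarith)]
  have key2 : ∀ x y : ℝ, 0 < x → 0 < y → max (x - (1 + y)) 0 = if x ≤ 1 + y then 0 else x - 1 - y := by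
    intro x y hx hy
    split_ifs with c1
    · rw [max_eq_right (by linarith)]
    · rw [max_eq_left (by linarith)]; ring
  have key3 : ∀ y : ℝ, |1 - y| = if y ≤ 1 then 1 - y else y - 1 := by
    intro y
    split_ifs with c1
    · rw [abs_of_nonneg (by linarith)]
    · rw [abs_of_nonpos (by linarith)]; ring
  rw [key ρ σ h0 h, key σ ρ h h0, key2 ρ σ h0 h, key2 σ ρ h h0, key3, key3, add_comm σ ρ]
  split_ifs <;> first | (exfalso; linarith) | (field_simp; ring)

lemma measurable_wk : Measurable (fun p : ℝ × ℝ => wk p.1 p.2) := by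
  unfold wk Hf
  refine Measurable.ite (measurableSet_eq_fun (by fun_prop) (by fun_prop)) (by fun_prop) (by fun_prop)

lemma continuousOn_wk {r s : ℝ} (hr : 0 ≤ r) (hs : 0 ≤ s) :
    ContinuousOn (fun p : ℝ × ℝ => wk (r / p.1) (s / p.2)) (Ioi 0 ×ˢ Ioi 0) := by
  rcases hr.eq_or_lt with h | h
  · subst h
    have : ContinuousOn (fun p : ℝ × ℝ => (max 1 (s / p.2))⁻¹) (Ioi 0 ×ˢ Ioi 0) := by
      refine ContinuousOn.inv₀ ((continuous_const.max continuous_id).comp_continuousOn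
        (ContinuousOn.div continuousOn_const continuousOn_snd ?_)) ?_
      · rintro p ⟨_, hp⟩; exact (ne_of_gt hp)
      · intro p _; positivity
    refine this.congr ?_
    rintro p ⟨_, hp⟩
    have hp' : 0 < p.2 := hp
    simp only [zero_div]
    exact wk_zero (by positivity)
  rcases hs.eq_or_lt with h' | h'
  · subst h'
    have : ContinuousOn (fun p : ℝ × ℝ => (max 1 (r / p.1))⁻¹) (Ioi 0 ×ˢ Ioi 0) := by
      refine ContinuousOn.inv₀ ((continuous_const.max continuous_id).comp_continuousOn
        (ContinuousOn.div continuousOn_const continuousOn_fst ?_)) ?_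
      · rintro p ⟨hp, _⟩; exact (ne_of_gt hp)
      · intro p _; positivity
    refine this.congr ?_
    rintro p ⟨_, hp⟩
    simp [wk]
  have : ContinuousOn (fun p : ℝ × ℝ => (Hf (r / p.1) (1 + s / p.2) - Hf (r / p.1) |1 - s / p.2|) / (2 * (s / p.2)))
      (Ioi 0 ×ˢ Ioi 0) := by
    unfold Hf
    have h1 : ContinuousOn (fun p : ℝ × ℝ => r / p.1) (Ioi 0 ×ˢ Ioi 0) :=
      ContinuousOn.div continuousOn_const continuousOn_fst (by rintro p ⟨hp, _⟩; exact (ne_of_gt hp))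
    have h2 : ContinuousOn (fun p : ℝ × ℝ => s / p.2) (Ioi 0 ×ˢ Ioi 0) :=
      ContinuousOn.div continuousOn_const continuousOn_snd (by rintro p ⟨_, hp⟩; exact (ne_of_gt hp))
    have hn1 : ∀ p ∈ (Ioi 0 ×ˢ Ioi 0 : Set (ℝ × ℝ)), 2 * (r / p.1) ≠ 0 := by
      rintro p ⟨hp, _⟩
      have hp' : 0 < p.1 := hp
      positivity
    have hn2 : ∀ p ∈ (Ioi 0 ×ˢ Ioi 0 : Set (ℝ × ℝ)), 2 * (s / p.2) ≠ 0 := by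
      rintro p ⟨_, hp⟩
      have hp' : 0 < p.2 := hp
      positivity
    have h3 : ContinuousOn (fun p : ℝ × ℝ => |1 - s / p.2|) (Ioi 0 ×ˢ Ioi 0) :=
      (continuousOn_const.sub h2).abs
    refine ContinuousOn.div (ContinuousOn.sub (ContinuousOn.add (continuousOn_const.add h2)
      (ContinuousOn.div (ContinuousOn.pow ((continuous_id.max continuous_const).comp_continuousOn (h1.sub (continuousOn_const.add h2))) _)
        (continuousOn_const.mul h1) hn1)) (ContinuousOn.add h3
      (ContinuousOn.div (ContinuousOn.pow ((continuous_id.max continuous_const).comp_continuousOn (h1.sub h3)) _)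
        (continuousOn_const.mul h1) hn1))) (continuousOn_const.mul h2) hn2
  refine this.congr ?_
  rintro p ⟨_, hp⟩
  have hp' : 0 < p.2 := hp
  have : s / p.2 ≠ 0 := by positivity
  simp only [wk]
  rw [if_neg this]

def WW (μ ν : Measure E3) (a b : ℝ) : ℝ := ∫ p, wk (‖p.1‖ / a) (‖p.2‖ / b) ∂(μ.prod ν)

def W0 (ν : Measure E3) (b : ℝ) : ℝ := ∫ y, (max 1 (‖y‖ / b))⁻¹ ∂ν

section

variable {μ ν : Measure E3} [IsProbabilityMeasure μ] [IsProbabilityMeasure ν]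

lemma wk_meas (a b : ℝ) : Measurable (fun p : E3 × E3 => wk (‖p.1‖ / a) (‖p.2‖ / b)) :=
  measurable_wk.comp (f := fun p : E3 × E3 => (‖p.1‖ / a, ‖p.2‖ / b)) (by fun_prop)

lemma wk_abs {a b : ℝ} (ha : 0 < a) (hb : 0 < b) (p : E3 × E3) : ‖wk (‖p.1‖ / a) (‖p.2‖ / b)‖ ≤ 1 := by
  rw [Real.norm_of_nonneg (wk_nonneg (by positivity) (by positivity))]
  exact wk_le_one (by positivity) (by positivity)

lemma wk_int {a b : ℝ} (ha : 0 < a) (hb : 0 < b) :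
    Integrable (fun p : E3 × E3 => wk (‖p.1‖ / a) (‖p.2‖ / b)) (μ.prod ν) :=
  Integrable.of_bound (wk_meas a b).aestronglyMeasurable 1 (Eventually.of_forall (wk_abs ha hb))

lemma W0_int (b : ℝ) : Integrable (fun y : E3 => (max 1 (‖y‖ / b))⁻¹) ν :=
  Integrable.of_bound (by fun_prop) 1 (Eventually.of_forall fun y => by
    rw [Real.norm_of_nonneg (by positivity)]; exact inv_max_le_one _)

lemma WW_nonneg {a b : ℝ} (ha : 0 < a) (hb : 0 < b) : 0 ≤ WW μ ν a b :=
  integral_nonneg fun p => wk_nonneg (by positivity) (by positivity)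

lemma W0_prod (b : ℝ) : W0 ν b = ∫ p, (max 1 (‖p.2‖ / b))⁻¹ ∂(μ.prod ν) := by
  rw [integral_fun_snd (μ := μ) (ν := ν) (fun y : E3 => (max 1 (‖y‖ / b))⁻¹)]
  simp [W0]

lemma W0_prod_int (b : ℝ) : Integrable (fun p : E3 × E3 => (max 1 (‖p.2‖ / b))⁻¹) (μ.prod ν) :=
  Integrable.of_bound (by fun_prop) 1 (Eventually.of_forall fun y => by
    rw [Real.norm_of_nonneg (by positivity)]; exact inv_max_le_one _)

lemma WW_le {a b : ℝ} (ha : 0 < a) (hb : 0 < b) : WW μ ν a b ≤ W0 ν b := by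
  rw [W0_prod (μ := μ)]
  exact integral_mono (wk_int ha hb) (W0_prod_int b) fun p => wk_le (by positivity) (by positivity)

lemma W0_le_one (b : ℝ) : W0 ν b ≤ 1 := by
  have := integral_mono (W0_int (ν := ν) b) (integrable_const (1:ℝ)) fun y => inv_max_le_one _
  simpa [W0] using this

lemma WW_le_one {a b : ℝ} (ha : 0 < a) (hb : 0 < b) : WW μ ν a b ≤ 1 :=
  (WW_le ha hb).trans (W0_le_one b)

lemma ae_le_one (hμs : μ (closedBall (0:E3) 1)ᶜ = 0) : ∀ᵐ x ∂μ, ‖x‖ ≤ 1 := by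
  have := measure_eq_zero_iff_ae_notMem.1 hμs
  filter_upwards [this] with x hx
  simpa using hx

lemma ae_prod_le_one (hμs : μ (closedBall (0:E3) 1)ᶜ = 0) (hνs : ν (closedBall (0:E3) 1)ᶜ = 0) :
    ∀ᵐ p ∂(μ.prod ν), ‖p.1‖ ≤ 1 ∧ ‖p.2‖ ≤ 1 := by
  filter_upwards [Measure.quasiMeasurePreserving_fst.ae (ae_le_one hμs),
    Measure.quasiMeasurePreserving_snd.ae (ae_le_one hνs)] with p h1 h2 using ⟨h1, h2⟩

lemma WW_close (hμs : μ (closedBall (0:E3) 1)ᶜ = 0) {a b : ℝ} (ha : 2 ≤ a) (hb : 0 < b) :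
    W0 ν b - 1 / a ≤ WW μ ν a b := by
  have ha' : 0 < a := by linarith
  have h1 : ∫ p, ((max 1 (‖p.2‖ / b))⁻¹ - 1 / a) ∂(μ.prod ν) ≤ WW μ ν a b := by
    refine integral_mono_ae ((W0_prod_int b).sub (integrable_const _)) (wk_int ha' hb) ?_
    filter_upwards [Measure.quasiMeasurePreserving_fst.ae (ae_le_one hμs)] with p hp
    have h2 : ‖p.1‖ / a ≤ 1 / a := by gcongr
    have h3 : 1 / a ≤ 1 / 2 := by gcongr
    have := wk_close (ρ := ‖p.1‖ / a) (σ := ‖p.2‖ / b) (by positivity) (by linarith) (by positivity)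
    linarith
  rw [integral_sub (W0_prod_int b) (integrable_const _), ← W0_prod] at h1
  simpa using h1

lemma WW_one (hμs : μ (closedBall (0:E3) 1)ᶜ = 0) (hνs : ν (closedBall (0:E3) 1)ᶜ = 0)
    {a b : ℝ} (ha : 0 < a) (hb : 0 < b) (h : 1 / a + 1 / b ≤ 1) : WW μ ν a b = 1 := by
  have : WW μ ν a b = ∫ p, (1:ℝ) ∂(μ.prod ν) := by
    refine integral_congr_ae ?_
    filter_upwards [ae_prod_le_one hμs hνs] with p hp
    refine wk_one (by positivity) (by positivity) ?_
    have h1 : ‖p.1‖ / a ≤ 1 / a := by gcongr; exact hp.1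
    have h2 : ‖p.2‖ / b ≤ 1 / b := by gcongr; exact hp.2
    linarith
  rw [this]; simp

lemma W0_one (hνs : ν (closedBall (0:E3) 1)ᶜ = 0) {b : ℝ} (hb : 1 ≤ b) : W0 ν b = 1 := by
  have : W0 ν b = ∫ y, (1:ℝ) ∂ν := by
    refine integral_congr_ae ?_
    filter_upwards [ae_le_one hνs] with y hy
    have : ‖y‖ / b ≤ 1 := by rw [div_le_one (by linarith)]; linarith
    simp [max_eq_left this]
  rw [this]; simp

lemma WW_symm {a b : ℝ} (ha : 0 < a) (hb : 0 < b) : WW μ ν a b = WW ν μ b a := by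
  unfold WW
  rw [← integral_prod_swap]
  congr 1
  ext p
  exact wk_symm (by simp only [Prod.fst_swap]; positivity) (by simp only [Prod.snd_swap]; positivity)

lemma WW_cont : ContinuousOn (fun p : ℝ × ℝ => WW μ ν p.1 p.2) (Ioi 0 ×ˢ Ioi 0) := by
  refine continuousOn_of_dominated (bound := fun _ => 1)
    (F := fun (q : ℝ × ℝ) (p : E3 × E3) => wk (‖p.1‖ / q.1) (‖p.2‖ / q.2)) ?_ ?_ (integrable_const _) ?_
  · intro q _; exact (wk_meas _ _).aestronglyMeasurable
  · rintro q ⟨h1, h2⟩; exact Eventually.of_forall (wk_abs h1 h2)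
  · exact Eventually.of_forall fun p => continuousOn_wk (norm_nonneg _) (norm_nonneg _)

lemma W0_tendsto : Tendsto (W0 ν) (𝓝[>] 0) (𝓝 (ν.real {0})) := by
  have hl : ν.real {0} = ∫ y, ({0} : Set E3).indicator (fun _ => (1:ℝ)) y ∂ν := by
    rw [integral_indicator (measurableSet_singleton _)]; simp [Measure.real]
  rw [hl]
  refine tendsto_integral_filter_of_dominated_convergence (fun _ => 1) ?_ ?_ (integrable_const _) ?_
  · exact Eventually.of_forall fun b => (W0_int b).aestronglyMeasurable
  · refine Eventually.of_forall fun b => Eventually.of_forall fun y => ?_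
    rw [Real.norm_of_nonneg (by positivity)]; exact inv_max_le_one _
  · refine Eventually.of_forall fun y => ?_
    by_cases hy : y = 0
    · subst hy; simp
    · have hy' : 0 < ‖y‖ := norm_pos_iff.2 hy
      simp only [mem_singleton_iff, hy, not_false_eq_true, indicator_of_notMem]
      have h1 : Tendsto (fun b : ℝ => b / ‖y‖) (𝓝[>] 0) (𝓝 0) := by
        have : Tendsto (fun b : ℝ => b / ‖y‖) (𝓝 0) (𝓝 (0 / ‖y‖)) :=
          (continuous_id.div_const _).tendsto 0
        rw [zero_div] at this
        exact this.mono_left nhdsWithin_le_nhds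
      refine tendsto_of_tendsto_of_tendsto_of_le_of_le' tendsto_const_nhds h1 ?_ ?_
      · exact Eventually.of_forall fun b => by positivity
      · filter_upwards [self_mem_nhdsWithin] with b hb
        have hb' : 0 < b := hb
        rw [show b / ‖y‖ = (‖y‖ / b)⁻¹ from (inv_div _ _).symm]
        exact inv_anti₀ (by positivity) (le_max_right _ _)

lemma WW_self_ge {a b : ℝ} (ha : 0 < a) (hb : 0 < b) : (ν.real {0}) ^ 2 ≤ WW ν ν a b := by
  have h1 : (ν.real {0}) ^ 2 =
      ∫ p, (({0} : Set E3) ×ˢ ({0} : Set E3)).indicator (fun _ => (1:ℝ)) p ∂(ν.prod ν) := by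
    rw [integral_indicator ((measurableSet_singleton _).prod (measurableSet_singleton _))]
    simp only [integral_const, MeasurableSet.univ, measureReal_restrict_apply, univ_inter, smul_eq_mul, mul_one]
    rw [measureReal_prod_prod, sq]
  rw [h1]
  refine integral_mono ((integrable_const _).indicator
    ((measurableSet_singleton _).prod (measurableSet_singleton _))) (wk_int ha hb) fun p => ?_
  by_cases hp : p ∈ (({0} : Set E3) ×ˢ ({0} : Set E3))
  · have h1 : p.1 = 0 := hp.1
    have h2 : p.2 = 0 := hp.2
    simp only [indicator_of_mem hp, h1, h2, norm_zero, zero_div]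
    simp [wk]
  · rw [indicator_of_notMem hp]
    exact wk_nonneg (by positivity) (by positivity)

lemma Phi_eq (hμ : IsRadial μ) (hν : IsRadial ν) {a b : ℝ} (ha : 0 < a) (hb : 0 < b) :
    Phi μ ν a b = a ^ 3 * b ^ 3 * (1 - WW μ ν a b) := by
  unfold Phi Dr
  rw [if_pos ⟨ha, hb⟩, DD_eq hμ hν ha hb]
  have h1 : ∫⁻ x, ∫⁻ y, ENNReal.ofReal (wk (‖x‖ / a) (‖y‖ / b)) ∂ν ∂μ = ENNReal.ofReal (WW μ ν a b) := by
    unfold WW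
    rw [ofReal_integral_eq_lintegral_ofReal (wk_int ha hb)
      (Eventually.of_forall fun p => wk_nonneg (by positivity) (by positivity)),
      lintegral_prod _ (wk_meas a b).ennreal_ofReal.aemeasurable]
  rw [h1, half_ofReal, ENNReal.toReal_ofReal (by have := WW_nonneg (μ := μ) (ν := ν) ha hb; positivity)]
  ring

lemma Phi_zero (μ ν : Measure E3) {a b : ℝ} (h : a ≤ 0 ∨ b ≤ 0) : Phi μ ν a b = 0 := by
  unfold Phi
  rw [if_neg]
  rintro ⟨h1, h2⟩
  rcases h with h | h <;> linarith

lemma Phi_bounds (hμ : IsRadial μ) (hν : IsRadial ν) (a b : ℝ) :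
    0 ≤ Phi μ ν a b ∧ Phi μ ν a b ≤ (max a 0) ^ 3 * (max b 0) ^ 3 := by
  by_cases h : a ≤ 0 ∨ b ≤ 0
  · rw [Phi_zero μ ν h]; exact ⟨le_rfl, by positivity⟩
  · push Not at h
    rw [Phi_eq hμ hν h.1 h.2, max_eq_left h.1.le, max_eq_left h.2.le]
    have h1 := WW_nonneg (μ := μ) (ν := ν) h.1 h.2
    have h2 := WW_le_one (μ := μ) (ν := ν) h.1 h.2
    have h3 : 0 < a ^ 3 * b ^ 3 := mul_pos (pow_pos h.1 3) (pow_pos h.2 3)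
    constructor
    · apply mul_nonneg h3.le; linarith
    · nlinarith

lemma Phi_cont (hμ : IsRadial μ) (hν : IsRadial ν) : Continuous (fun p : ℝ × ℝ => Phi μ ν p.1 p.2) := by
  rw [continuous_iff_continuousAt]
  rintro ⟨a, b⟩
  by_cases h : a ≤ 0 ∨ b ≤ 0
  · unfold ContinuousAt
    simp only [Phi_zero μ ν h]
    have hc : Continuous (fun p : ℝ × ℝ => (max p.1 0) ^ 3 * (max p.2 0) ^ 3) := by fun_prop
    have h0 := hc.tendsto (a, b)
    have : (max a 0) ^ 3 * (max b 0) ^ 3 = 0 := by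
      rcases h with h | h <;> simp [max_eq_right h]
    simp only [this] at h0
    exact squeeze_zero (fun p => (Phi_bounds hμ hν _ _).1) (fun p => (Phi_bounds hμ hν _ _).2) h0
  · push Not at h
    have hn : (Ioi 0 ×ˢ Ioi 0 : Set (ℝ × ℝ)) ∈ 𝓝 (a, b) := prod_mem_nhds (Ioi_mem_nhds h.1) (Ioi_mem_nhds h.2)
    have hW : ContinuousAt (fun p : ℝ × ℝ => WW μ ν p.1 p.2) (a, b) := WW_cont.continuousAt hn
    have h2 : ContinuousAt (fun p : ℝ × ℝ => p.1 ^ 3 * p.2 ^ 3 * (1 - WW μ ν p.1 p.2)) (a, b) := by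
      have h3 : ContinuousAt (fun p : ℝ × ℝ => p.1 ^ 3 * p.2 ^ 3) (a, b) := by fun_prop
      exact h3.mul (continuousAt_const.sub hW)
    refine h2.congr ?_
    filter_upwards [hn] with p hp
    exact (Phi_eq hμ hν hp.1 hp.2).symm

lemma Phi_symm (hμ : IsRadial μ) (hν : IsRadial ν) (a b : ℝ) : Phi μ ν a b = Phi ν μ b a := by
  by_cases h : a ≤ 0 ∨ b ≤ 0
  · rw [Phi_zero μ ν h, Phi_zero ν μ h.symm]
  · push Not at h
    rw [Phi_eq hμ hν h.1 h.2, Phi_eq hν hμ h.2 h.1, WW_symm h.1 h.2]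
    ring

lemma Psi_eq (hμ : IsRadial μ) (hν : IsRadial ν) {a b : ℝ} (ha : 0 < a) (hb : 0 < b) :
    Psi μ ν a b = a ^ 3 * b ^ 3 * (1 - WW μ ν a b - WW ν μ a b + WW ν ν a b) := by
  unfold Psi
  rw [Phi_eq hμ hν ha hb, Phi_eq hν hμ ha hb, Phi_eq hν hν ha hb]
  ring

end

section

variable {μ ν : Measure E3} [IsProbabilityMeasure μ] [IsProbabilityMeasure ν]

lemma Vpot_eq (hμ : IsRadial μ) {b : ℝ} (hb : 0 < b) : b * Vpot μ (b • e1) = W0 μ b := by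
  have h1 : ∫⁻ y, coul (b • e1) y ∂μ = ENNReal.ofReal (b⁻¹ * W0 μ b) := by
    have h2 := newton hμ one_pos (b • e1)
    have h3 : ∀ y : E3, coul (b • e1) y = (ENNReal.ofReal ‖(1:ℝ)⁻¹ • y - b • e1‖)⁻¹ := by
      intro y
      rw [inv_one, one_smul, norm_sub_rev]; rfl
    simp_rw [h3]
    rw [h2, W0, ← integral_const_mul, ofReal_integral_eq_lintegral_ofReal ((W0_int b).const_mul _)
      (Eventually.of_forall fun y => by positivity)]
    congr 1
    ext x
    rw [norm_smul, norm_e1, Real.norm_of_nonneg hb.le, mul_one, div_one,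
      ← ENNReal.ofReal_inv_of_pos (lt_max_of_lt_right hb), ← mul_inv, mul_max_of_nonneg _ _ hb.le,
      mul_one, mul_div_cancel₀ _ hb.ne', max_comm]
  have h0 : 0 ≤ W0 μ b := integral_nonneg fun y => by positivity
  rw [Vpot, h1, ENNReal.toReal_ofReal (by positivity)]
  field_simp

lemma Psi_cont (hμ : IsRadial μ) (hν : IsRadial ν) : Continuous (fun p : ℝ × ℝ => Psi μ ν p.1 p.2) :=
  ((Phi_cont hμ hν).add (Phi_cont hν hμ)).sub (Phi_cont hν hν)

lemma Psi_symm (hμ : IsRadial μ) (hν : IsRadial ν) (a b : ℝ) : Psi μ ν a b = Psi μ ν b a := by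
  unfold Psi
  rw [Phi_symm hμ hν a b, Phi_symm hν hμ a b, Phi_symm hν hν a b]
  ring

lemma Psi_le (hμ : IsRadial μ) (hν : IsRadial ν) {a b : ℝ} (ha : 0 ≤ a) (hb : 0 ≤ b) :
    Psi μ ν a b ≤ 2 * (a ^ 3 * b ^ 3) := by
  unfold Psi
  have h1 := (Phi_bounds hμ hν a b).2
  have h2 := (Phi_bounds hν hμ a b).2
  have h3 := (Phi_bounds hν hν a b).1
  rw [max_eq_left ha, max_eq_left hb] at h1 h2
  linarith

lemma Psi_zero {a b : ℝ} (h : b ≤ 0) : Psi μ ν a b = 0 := by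
  unfold Psi
  rw [Phi_zero _ _ (Or.inr h), Phi_zero _ _ (Or.inr h), Phi_zero _ _ (Or.inr h)]
  simp

lemma fcont (hμ : IsRadial μ) (hν : IsRadial ν) :
    Continuous (fun p : ℝ × ℝ => Psi μ ν p.1 p.2 - max (Psi μ ν p.2 p.2) 0 / 2) := by
  have h1 := Psi_cont hμ hν
  have h2 : Continuous (fun p : ℝ × ℝ => Psi μ ν p.2 p.2) :=
    h1.comp (g := fun p : ℝ × ℝ => Psi μ ν p.1 p.2) (f := fun p : ℝ × ℝ => (p.2, p.2)) (by fun_prop)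
  exact h1.sub ((h2.max continuous_const).div_const 2)

lemma le_g (hμ : IsRadial μ) (hν : IsRadial ν) {a b : ℝ} (hb : b ∈ Icc 0 a) :
    Psi μ ν a b - max (Psi μ ν b b) 0 / 2 ≤ gPsi μ ν a := by
  have hc : Continuous (fun b : ℝ => Psi μ ν a b - max (Psi μ ν b b) 0 / 2) :=
    (fcont hμ hν).comp (f := fun b : ℝ => (a, b)) (by fun_prop)
  exact le_csSup (isCompact_Icc.image hc).bddAbove (mem_image_of_mem _ hb)

lemma g_le {a M : ℝ} (ha : 0 ≤ a)
    (h : ∀ b ∈ Icc 0 a, Psi μ ν a b - max (Psi μ ν b b) 0 / 2 ≤ M) : gPsi μ ν a ≤ M := by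
  refine csSup_le ⟨_, mem_image_of_mem _ ⟨le_rfl, ha⟩⟩ ?_
  rintro _ ⟨b, hb, rfl⟩
  exact h b hb

lemma g_nonneg (hμ : IsRadial μ) (hν : IsRadial ν) {a : ℝ} (ha : 0 ≤ a) : 0 ≤ gPsi μ ν a := by
  have := le_g hμ hν (b := 0) ⟨le_rfl, ha⟩
  simpa [Psi_zero (μ := μ) (ν := ν) (le_refl (0:ℝ))] using this

lemma g_cont (hμ : IsRadial μ) (hν : IsRadial ν) : ContinuousOn (gPsi μ ν) (Ici 0) := by
  have h1 : Continuous (fun a : ℝ => sSup ((fun τ : ℝ =>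
      Psi μ ν a (a * τ) - max (Psi μ ν (a * τ) (a * τ)) 0 / 2) '' Icc 0 1)) := by
    refine IsCompact.continuous_sSup (f := fun a τ : ℝ =>
      Psi μ ν a (a * τ) - max (Psi μ ν (a * τ) (a * τ)) 0 / 2) isCompact_Icc ?_
    exact (fcont hμ hν).comp (f := fun p : ℝ × ℝ => (p.1, p.1 * p.2)) (by fun_prop)
  refine h1.continuousOn.congr ?_
  intro a ha
  have ha' : 0 ≤ a := ha
  unfold gPsi
  congr 1
  ext v
  constructor
  · rintro ⟨b, hb, rfl⟩
    rcases ha'.eq_or_lt with h | h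
    · subst h
      have : b = 0 := le_antisymm hb.2 hb.1
      subst this
      exact ⟨0, ⟨le_rfl, zero_le_one⟩, by simp⟩
    · refine ⟨b / a, ⟨div_nonneg hb.1 ha', (div_le_one h).2 hb.2⟩, ?_⟩
      simp only [mul_div_cancel₀ _ h.ne']
  · rintro ⟨τ, hτ, rfl⟩
    exact ⟨a * τ, ⟨mul_nonneg ha' hτ.1, mul_le_of_le_one_right ha' hτ.2⟩, rfl⟩

lemma Psi_le_g (hμ : IsRadial μ) (hν : IsRadial ν) {a b : ℝ} (hb : 0 ≤ b) (hab : b ≤ a) :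
    Psi μ ν a b ≤ gPsi μ ν a + gPsi μ ν b := by
  have h1 := le_g hμ hν (a := a) (b := b) ⟨hb, hab⟩
  have h2 := le_g hμ hν (a := b) (b := b) ⟨hb, le_rfl⟩
  have h3 := g_nonneg hμ hν hb
  rcases le_total (Psi μ ν b b) 0 with h | h
  · rw [max_eq_right h] at h1; linarith
  · rw [max_eq_left h] at h1 h2; linarith

lemma g_mem (hμ : IsRadial μ) (hν : IsRadial ν) : gPsi μ ν ∈ FF μ ν := by
  refine ⟨g_cont hμ hν, fun a ha => g_nonneg hμ hν ha, fun a b ha hb => ?_⟩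
  rcases le_total b a with h | h
  · exact Psi_le_g hμ hν hb h
  · rw [Psi_symm hμ hν, add_comm]; exact Psi_le_g hμ hν ha h

lemma Psi_far (hμ : IsRadial μ) (hν : IsRadial ν)
    (hμs : μ (closedBall (0:E3) 1)ᶜ = 0) (hνs : ν (closedBall (0:E3) 1)ᶜ = 0)
    {a b : ℝ} (ha : 0 < a) (hb : 0 < b) (h : 1 / a + 1 / b ≤ 1) : Psi μ ν a b = 0 := by
  rw [Psi_eq hμ hν ha hb, WW_one hμs hνs ha hb h, WW_one hνs hμs ha hb h, WW_one hνs hνs ha hb h]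
  ring

lemma g_upper (hμ : IsRadial μ) (hν : IsRadial ν)
    (hμs : μ (closedBall (0:E3) 1)ᶜ = 0) (hνs : ν (closedBall (0:E3) 1)ᶜ = 0) (a : ℝ) (ha : 0 ≤ a) :
    gPsi μ ν a ≤ 2 * a ^ 6 * (if a ≤ 2 then 1 else ((a - 1) ^ 3)⁻¹) := by
  refine g_le ha fun b hb => ?_
  have hm : 0 ≤ max (Psi μ ν b b) 0 := le_max_right _ _
  have h1 := Psi_le hμ hν ha hb.1
  split_ifs with h2
  · have : a ^ 3 * b ^ 3 ≤ a ^ 3 * a ^ 3 := by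
      have := hb.1
      gcongr
      exact hb.2
    nlinarith
  · push Not at h2
    have ha1 : 0 < a - 1 := by linarith
    have hR : 2 * a ^ 6 * ((a - 1) ^ 3)⁻¹ = 2 * (a ^ 3 * (a / (a - 1)) ^ 3) := by
      field_simp
    rw [hR]
    rcases le_total b (a / (a - 1)) with h3 | h3
    · have : a ^ 3 * b ^ 3 ≤ a ^ 3 * (a / (a - 1)) ^ 3 := by
        have := hb.1
        gcongr
      linarith
    · have h4 : 0 < a / (a - 1) := by positivity
      have : Psi μ ν a b = 0 := by
        refine Psi_far hμ hν hμs hνs (by linarith) (by linarith) ?_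
        have : 1 / b ≤ 1 / (a / (a - 1)) := by gcongr
        have h5 : 1 / (a / (a - 1)) = 1 - 1 / a := by field_simp
        linarith
      rw [this]
      have : 0 ≤ 2 * (a ^ 3 * (a / (a - 1)) ^ 3) := by positivity
      linarith

lemma bound_elem (a : ℝ) (ha : 0 ≤ a) :
    2 * a ^ 6 * (if a ≤ 2 then 1 else ((a - 1) ^ 3)⁻¹) ≤ min (2 * a ^ 6) (16 * a ^ 3) := by
  have h3 : 0 ≤ a ^ 3 := by positivity
  split_ifs with h
  · refine le_min (by linarith) ?_
    have : a ^ 3 ≤ 2 ^ 3 := by gcongr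
    nlinarith
  · push Not at h
    have h1 : 0 < a - 1 := by linarith
    refine le_min ?_ ?_
    · have : ((a - 1) ^ 3)⁻¹ ≤ 1 := inv_le_one_of_one_le₀ (one_le_pow₀ (by linarith))
      have h6 : 0 ≤ 2 * a ^ 6 := by positivity
      nlinarith
    · rw [← div_eq_mul_inv, div_le_iff₀ (by positivity)]
      have : a ^ 3 ≤ (2 * (a - 1)) ^ 3 := by gcongr; linarith
      nlinarith

lemma g_lower (hμ : IsRadial μ) (hν : IsRadial ν) (hμ0 : μ {0} = 0) :
    ∃ c : ℝ, 0 < c ∧ ∀ a : ℝ, 0 ≤ a → c * min (a ^ 3) (a ^ 6) ≤ gPsi μ ν a := by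
  have ht : Tendsto (fun b => 1 - W0 μ b - W0 ν b + (ν.real {0}) ^ 2) (𝓝[>] 0)
      (𝓝 (1 - μ.real {0} - ν.real {0} + (ν.real {0}) ^ 2)) :=
    (((tendsto_const_nhds (x := (1:ℝ))).sub W0_tendsto).sub W0_tendsto).add tendsto_const_nhds
  have hgt : (1:ℝ) / 2 < 1 - μ.real {0} - ν.real {0} + (ν.real {0}) ^ 2 := by
    have : μ.real {0} = 0 := by simp [Measure.real, hμ0]
    rw [this]
    nlinarith [sq_nonneg (ν.real {0} - 1 / 2)]
  have hev := ht.eventually (lt_mem_nhds hgt)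
  rw [eventually_nhdsWithin_iff, Metric.eventually_nhds_iff] at hev
  obtain ⟨ε, hε, hev⟩ := hev
  set b0 := min (ε / 2) (1 / 2) with hb0
  have hb0p : 0 < b0 := lt_min (by linarith) (by norm_num)
  have hb0h : b0 ≤ 1 / 2 := min_le_right _ _
  have hq : ∀ b, 0 < b → b ≤ b0 → 1 / 2 < 1 - W0 μ b - W0 ν b + (ν.real {0}) ^ 2 := by
    intro b hb hb'
    refine hev ?_ hb
    rw [Real.dist_eq, sub_zero, abs_of_pos hb]
    have := min_le_left (ε / 2) (1 / 2)
    linarith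
  refine ⟨3 / 8 * b0 ^ 3, by positivity, fun a ha => ?_⟩
  rcases ha.eq_or_lt with h | h
  · subst h
    have := g_nonneg hμ hν (le_refl (0:ℝ))
    simpa using this
  set b := b0 * min a 1 with hb
  have hmp : 0 < min a 1 := lt_min h one_pos
  have hbp : 0 < b := mul_pos hb0p hmp
  have hbb : b ≤ b0 := mul_le_of_le_one_right hb0p.le (min_le_right _ _)
  have hba : b ≤ a / 2 := by
    have : b ≤ 1 / 2 * a := by
      rw [hb]; gcongr; exact min_le_left _ _
    linarith
  have h1 := le_g hμ hν (a := a) (b := b) ⟨hbp.le, by linarith⟩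
  have h2 := Psi_le hμ hν hbp.le hbp.le
  have h2' : max (Psi μ ν b b) 0 ≤ 2 * (b ^ 3 * b ^ 3) := max_le h2 (by positivity)
  have h3 : b ^ 3 ≤ (a / 2) ^ 3 := by gcongr
  have h4 : a ^ 3 * b ^ 3 * (1 / 2) ≤ Psi μ ν a b := by
    rw [Psi_eq hμ hν h hbp]
    have i1 := WW_le (μ := μ) (ν := ν) h hbp
    have i2 := WW_le (μ := ν) (ν := μ) h hbp
    have i3 := WW_self_ge (ν := ν) h hbp
    have i4 := hq b hbp hbb
    gcongr
    linarith
  have h5 : min (a ^ 3) (a ^ 6) = a ^ 3 * (min a 1) ^ 3 := by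
    rcases le_total a 1 with h6 | h6
    · rw [min_eq_left h6, min_eq_right (pow_le_pow_of_le_one ha h6 (by norm_num))]; ring
    · rw [min_eq_right h6, min_eq_left (pow_le_pow_right₀ h6 (by norm_num))]; ring
  have h7 : 3 / 8 * b0 ^ 3 * min (a ^ 3) (a ^ 6) = 3 / 8 * (a ^ 3 * b ^ 3) := by
    rw [h5, hb]; ring
  rw [h7]
  have h8 : b ^ 3 * b ^ 3 ≤ (a / 2) ^ 3 * b ^ 3 := by gcongr
  have h9 : (a / 2) ^ 3 * b ^ 3 = a ^ 3 * b ^ 3 / 8 := by ring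
  linarith

lemma g_limit (hμ : IsRadial μ) (hν : IsRadial ν)
    (hμs : μ (closedBall (0:E3) 1)ᶜ = 0) (hνs : ν (closedBall (0:E3) 1)ᶜ = 0) :
    Tendsto (fun a => gPsi μ ν a / a ^ 3) atTop
      (𝓝 (sSup ((fun b => b ^ 3 * (1 - b * Vpot μ (b • e1))) '' Icc (0:ℝ) 1))) := by
  set L := sSup ((fun b => b ^ 3 * (1 - b * Vpot μ (b • e1))) '' Icc (0:ℝ) 1) with hL
  have hbdd : BddAbove ((fun b => b ^ 3 * (1 - b * Vpot μ (b • e1))) '' Icc (0:ℝ) 1) := by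
    refine ⟨1, ?_⟩
    rintro _ ⟨b, hb, rfl⟩
    have h0 : 0 ≤ b * Vpot μ (b • e1) := mul_nonneg hb.1 ENNReal.toReal_nonneg
    have h1 : b ^ 3 ≤ 1 := pow_le_one₀ hb.1 hb.2
    have h2 : 0 ≤ b ^ 3 := pow_nonneg hb.1 3
    simp only
    nlinarith
  have hLle : ∀ b ∈ Icc (0:ℝ) 1, b ^ 3 * (1 - b * Vpot μ (b • e1)) ≤ L := fun b hb =>
    le_csSup hbdd (mem_image_of_mem _ hb)
  have hL0 : 0 ≤ L := by simpa using hLle 0 ⟨le_rfl, zero_le_one⟩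
  -- approximation of Psi
  have happ : ∀ a b : ℝ, 2 ≤ a → 0 < b → b ≤ 2 →
      Psi μ ν a b ≤ a ^ 3 * (b ^ 3 * (1 - W0 μ b) + 24 / a) ∧
      a ^ 3 * (b ^ 3 * (1 - W0 μ b) - 24 / a) ≤ Psi μ ν a b := by
    intro a b ha hb hb2
    have ha' : 0 < a := by linarith
    rw [Psi_eq hμ hν ha' hb]
    have i1 := WW_le (μ := μ) (ν := ν) ha' hb
    have i2 := WW_le (μ := ν) (ν := μ) ha' hb
    have i3 := WW_le (μ := ν) (ν := ν) ha' hb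
    have j1 := WW_close (μ := μ) (ν := ν) hμs ha hb
    have j2 := WW_close (μ := ν) (ν := μ) hνs ha hb
    have j3 := WW_close (μ := ν) (ν := ν) hνs ha hb
    have k0 : 0 < 1 / a := by positivity
    have k1 : b ^ 3 ≤ 8 := by
      have : b ^ 3 ≤ 2 ^ 3 := by gcongr
      linarith
    have k2 : 0 < b ^ 3 := by positivity
    have k3 : b ^ 3 * (3 * (1 / a)) ≤ 8 * (3 * (1 / a)) := by gcongr
    have k4 : 24 / a = 8 * (3 * (1 / a)) := by ring
    rw [mul_assoc, k4]
    constructor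
    · refine mul_le_mul_of_nonneg_left ?_ (by positivity)
      have : b ^ 3 * (1 - WW μ ν a b - WW ν μ a b + WW ν ν a b) ≤ b ^ 3 * (1 - W0 μ b + 3 * (1 / a)) := by
        refine mul_le_mul_of_nonneg_left ?_ k2.le; linarith
      linarith
    · refine mul_le_mul_of_nonneg_left ?_ (by positivity)
      have : b ^ 3 * (1 - W0 μ b - 3 * (1 / a)) ≤ b ^ 3 * (1 - WW μ ν a b - WW ν μ a b + WW ν ν a b) := by
        refine mul_le_mul_of_nonneg_left ?_ k2.le; linarith
      linarith
  have hup : ∀ a : ℝ, 2 ≤ a → gPsi μ ν a / a ^ 3 ≤ L + 25 / a := by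
    intro a ha
    have ha' : 0 < a := by linarith
    have ha3 : 0 < a ^ 3 := by positivity
    have hpos : 0 < 25 / a := by positivity
    have h25 : 24 / a ≤ 25 / a := by gcongr; norm_num
    rw [div_le_iff₀ ha3, mul_comm]
    refine g_le ha'.le fun b hb => ?_
    have hm : 0 ≤ max (Psi μ ν b b) 0 := le_max_right _ _
    have hRp : 0 ≤ a ^ 3 * (L + 25 / a) := by positivity
    suffices Psi μ ν a b ≤ a ^ 3 * (L + 25 / a) by linarith
    rcases hb.1.eq_or_lt with h | h
    · rw [Psi_zero h.symm.le]; exact hRp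
    rcases le_total b 2 with h2 | h2
    · refine (happ a b ha h h2).1.trans ?_
      gcongr
      rcases le_total b 1 with h1 | h1
      · have := hLle b ⟨h.le, h1⟩
        rwa [Vpot_eq hμ h] at this
      · rw [W0_one hμs h1]; simpa using hL0
    · rw [Psi_far hμ hν hμs hνs ha' h]
      · exact hRp
      · have : 1 / a ≤ 1 / 2 := by gcongr
        have : 1 / b ≤ 1 / 2 := by gcongr
        linarith
  have hlow : ∀ a : ℝ, 2 ≤ a → L - 25 / a ≤ gPsi μ ν a / a ^ 3 := by
    intro a ha
    have ha' : 0 < a := by linarith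
    have ha3 : 0 < a ^ 3 := by positivity
    have hpos : 0 < 25 / a := by positivity
    rw [sub_le_iff_le_add]
    refine csSup_le ⟨_, mem_image_of_mem _ ⟨le_rfl, zero_le_one⟩⟩ ?_
    rintro _ ⟨b, hb, rfl⟩
    simp only
    rcases hb.1.eq_or_lt with h | h
    · subst h
      have := g_nonneg hμ hν ha'.le
      have : 0 ≤ gPsi μ ν a / a ^ 3 := by positivity
      simp only [ne_eq, OfNat.ofNat_ne_zero, not_false_eq_true, zero_pow, zero_mul]
      linarith
    · rw [Vpot_eq hμ h]
      have h1 := (happ a b ha h (by linarith [hb.2])).2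
      have h2 := le_g hμ hν (a := a) (b := b) ⟨h.le, by linarith [hb.2]⟩
      have h3 : max (Psi μ ν b b) 0 ≤ 2 := by
        refine max_le ((Psi_le hμ hν h.le h.le).trans ?_) (by norm_num)
        have : b ^ 3 ≤ 1 := pow_le_one₀ hb.1 hb.2
        have : 0 ≤ b ^ 3 := by positivity
        nlinarith
      have h4 : (1:ℝ) ≤ a ^ 3 * (1 / a) := by
        have : a ^ 3 * (1 / a) = a ^ 2 := by field_simp
        rw [this]; nlinarith
      rw [← sub_le_iff_le_add, le_div_iff₀ ha3]
      have e1 : 24 / a = 24 * (1 / a) := by ring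
      have e2 : 25 / a = 25 * (1 / a) := by ring
      rw [e1] at h1
      rw [e2]
      nlinarith
  have hz : Tendsto (fun a : ℝ => 25 / a) atTop (𝓝 0) := tendsto_const_nhds.div_atTop tendsto_id
  refine tendsto_of_tendsto_of_tendsto_of_le_of_le' (g := fun a => L - 25 / a) (h := fun a => L + 25 / a) ?_ ?_ ?_ ?_
  · simpa using (tendsto_const_nhds (x := L)).sub hz
  · simpa using (tendsto_const_nhds (x := L)).add hz
  · filter_upwards [eventually_ge_atTop 2] with a ha using hlow a ha
  · filter_upwards [eventually_ge_atTop 2] with a ha using hup a ha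

end

/-- **Lemma 4 of the paper**: for radial probability measures supported in the unit ball with
`μ({0}) = 0`, the function `g(a) = max_{0≤b≤a} {Ψ_{μν}(a,b) - Ψ_{μν}(b,b)₊/2}` belongs to
`𝓕_{μν}`, satisfies `c·min(a³,a⁶) ≤ g(a) ≤ 2a⁶(𝟙(a≤2) + 𝟙(a>2)/(a-1)³) ≤ min(2a⁶,16a³)`,
and `g(a)/a³ → max_{0≤b≤1} b³(1 - bV_μ(be₁))` as `a → ∞`. -/
theorem gPsi_properties (μ ν : Measure E3) [IsProbabilityMeasure μ] [IsProbabilityMeasure ν]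
    (hμrad : IsRadial μ) (hνrad : IsRadial ν)
    (hμs : μ (closedBall (0:E3) 1)ᶜ = 0) (hνs : ν (closedBall (0:E3) 1)ᶜ = 0)
    (hμ0 : μ {0} = 0) :
    gPsi μ ν ∈ FF μ ν ∧
    (∃ c : ℝ, 0 < c ∧ ∀ a : ℝ, 0 ≤ a → c * min (a ^ 3) (a ^ 6) ≤ gPsi μ ν a) ∧
    (∀ a : ℝ, 0 ≤ a →
      gPsi μ ν a ≤ 2 * a ^ 6 * (if a ≤ 2 then 1 else ((a - 1) ^ 3)⁻¹)) ∧
    (∀ a : ℝ, 0 ≤ a →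
      2 * a ^ 6 * (if a ≤ 2 then 1 else ((a - 1) ^ 3)⁻¹) ≤
        min (2 * a ^ 6) (16 * a ^ 3)) ∧
    Tendsto (fun a => gPsi μ ν a / a ^ 3) atTop
      (𝓝 (sSup ((fun b => b ^ 3 * (1 - b * Vpot μ (b • e1))) '' Icc (0:ℝ) 1))) := by
  exact ⟨g_mem hμrad hνrad, g_lower hμrad hνrad hμ0, g_upper hμrad hνrad hμs hνs, bound_elem,
    g_limit hμrad hνrad hμs hνs⟩
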